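/- Let Ā be the adjacency matrix of a connected bipartite undirected graph on N ≥ 2 vertices with bipartition V = V₁ ∪ V₂ (symmetric, zero diagonal, entries in {0,1}, irreducible, Ā_{ik} = 0 whenever i,k lie in the same part). Let λ_min be the smallest eigenvalue of Ā and let v^c be the unique positive unit eigenvector for the largest eigenvalue λ_max. Then every nonzero vector x in the λ_min-eigenspace of Ā satisfies, for all indices i, k: |x_i| < |x_k| if v^c_i < v^c_k, |x_i| = |x_k| if v^c_i = v^c_k, and sign(x_i) = −sign(x_k) for all i ∈ V₁ and k ∈ V₂ (in particular x_i ≠ 0 for all i). -/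

import Mathlib

open Matrix

theorem Matrix.pow_mulVec_eq_smul {n R : Type*} [Fintype n] [DecidableEq n] [CommSemiring R]
    {A : Matrix n n R} {μ : R} {v : n → R} (h : A.mulVec v = μ • v) (m : ℕ) :
    (A ^ m).mulVec v = μ ^ m • v := by
  induction m with
  | zero => simp
  | succ m ih => rw [pow_succ, ← mulVec_mulVec, h, mulVec_smul, ih, smul_smul, pow_succ']

/-- An eigenvector of an irreducible nonnegative matrix that shares its eigenvalue with a positive
eigenvector `v` is a multiple of `v`. -/
theorem Matrix.exists_eq_smul_of_pos_eigenvector {n : Type*} [Fintype n] [DecidableEq n]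
    [Nonempty n] {A : Matrix n n ℝ} (hA : ∀ i k, 0 ≤ A i k)
    (hirr : ∀ i k, ∃ m : ℕ, 1 ≤ m ∧ 0 < (A ^ m) i k) {μ : ℝ} {v y : n → ℝ}
    (hv : A.mulVec v = μ • v) (hpos : ∀ i, 0 < v i) (hy : A.mulVec y = μ • y) :
    ∃ c : ℝ, y = c • v := by
  obtain ⟨i₀, hi₀⟩ := Finite.exists_min fun i => y i / v i
  set c := y i₀ / v i₀ with hc
  have hz : A.mulVec (y - c • v) = μ • (y - c • v) := by
    rw [mulVec_sub, mulVec_smul, hv, hy, smul_sub, smul_comm]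
  have hz0 : ∀ i, 0 ≤ (y - c • v) i := fun i => by
    have := (le_div_iff₀ (hpos i)).1 (hi₀ i)
    simpa using this
  have hzi : (y - c • v) i₀ = 0 := by
    simp [hc, div_mul_cancel₀ _ (hpos i₀).ne']
  have hpow : ∀ m : ℕ, ∀ i k, 0 ≤ (A ^ m) i k := fun m => by
    induction m with
    | zero => intro i k; rw [pow_zero, one_apply]; split_ifs <;> norm_num
    | succ m ih =>
      intro i k
      rw [pow_succ, mul_apply]
      exact Finset.sum_nonneg fun j _ => mul_nonneg (ih i j) (hA j k)
  refine ⟨c, sub_eq_zero.1 (funext fun k => ?_)⟩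
  obtain ⟨m, -, hm⟩ := hirr i₀ k
  have hsum : ∑ j, (A ^ m) i₀ j * (y - c • v) j = 0 := by
    have := congrFun (pow_mulVec_eq_smul hz m) i₀
    rwa [Pi.smul_apply, hzi, smul_zero] at this
  have := (Finset.sum_eq_zero_iff_of_nonneg
    fun j _ => mul_nonneg (hpow m i₀ j) (hz0 j)).1 hsum k (Finset.mem_univ k)
  exact (mul_eq_zero.1 this).resolve_left hm.ne'

/-- Flipping signs on one part of a bipartition negates the eigenvalue. -/
theorem Matrix.mulVec_sign_flip {n : Type*} [Fintype n] {A : Matrix n n ℝ}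
    {P : n → Prop} [DecidablePred P] (hbip : ∀ i k, (P i ↔ P k) → A i k = 0)
    {μ : ℝ} {v : n → ℝ} (h : A.mulVec v = μ • v) :
    A.mulVec (fun i => (if P i then 1 else -1) * v i) =
      (-μ) • fun i => (if P i then 1 else -1) * v i := by
  funext i
  have hi : ∑ k, A i k * v k = μ * v i := congrFun h i
  change ∑ k, A i k * ((if P k then 1 else -1) * v k) = -μ * ((if P i then 1 else -1) * v i)
  rw [show -μ * ((if P i then 1 else -1) * v i) = -(if P i then 1 else -1) * (μ * v i) by ring,
    ← hi, Finset.mul_sum]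
  refine Finset.sum_congr rfl fun k _ => ?_
  by_cases hik : P i ↔ P k
  · simp [hbip i k hik]
  · by_cases hP : P i <;> by_cases hQ : P k <;> simp_all

/-- For the adjacency matrix of a connected bipartite graph on `N ≥ 2`
vertices with positive unit Perron eigenvector `v^c` for the largest eigenvalue `λ_max` and
smallest eigenvalue `λ_min`: every nonzero `λ_min`-eigenvector `x` has all entries nonzero,
satisfies `|x_i| < |x_k|` whenever `v^c_i < v^c_k`, `|x_i| = |x_k|` whenever
`v^c_i = v^c_k`, and has opposite signs on the two parts of the bipartition. -/
theorem stmt11 (N : ℕ) (hN : 2 ≤ N) (A : Matrix (Fin N) (Fin N) ℝ)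
    (hsym : A.IsSymm)
    (hdiag : ∀ i, A i i = 0)
    (h01 : ∀ i k, A i k = 0 ∨ A i k = 1)
    (hirr : ∀ i k, ∃ m : ℕ, 1 ≤ m ∧ 0 < (A ^ m) i k)
    (P : Fin N → Prop) [DecidablePred P]
    (hbip : ∀ i k, (P i ↔ P k) → A i k = 0)
    (lammax lammin : ℝ) (vc : Fin N → ℝ)
    (hvc : A.mulVec vc = lammax • vc)
    (hvcpos : ∀ i, 0 < vc i)
    (hvcunit : ∑ i, vc i ^ 2 = 1)
    (hmax : ∀ μ : ℝ, (∃ v : Fin N → ℝ, v ≠ 0 ∧ A.mulVec v = μ • v) → μ ≤ lammax)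
    (hmin : ∀ μ : ℝ, (∃ v : Fin N → ℝ, v ≠ 0 ∧ A.mulVec v = μ • v) → lammin ≤ μ) :
    ∀ x : Fin N → ℝ, x ≠ 0 → A.mulVec x = lammin • x →
      (∀ i, x i ≠ 0) ∧
      (∀ i k, (vc i < vc k → |x i| < |x k|) ∧ (vc i = vc k → |x i| = |x k|)) ∧
      (∀ i k, P i → ¬ P k → Real.sign (x i) = -Real.sign (x k)) := by
  intro x hx hAx
  have hN0 : NeZero N := ⟨by omega⟩
  have hs : ∀ i, (if P i then (1 : ℝ) else -1) ≠ 0 := fun i => by split_ifs <;> norm_num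
  have hflip : ∀ v : Fin N → ℝ, v ≠ 0 → (fun i => (if P i then (1 : ℝ) else -1) * v i) ≠ 0 :=
    fun v hv h => hv <| funext fun i => (mul_eq_zero.1 (congrFun h i)).resolve_left (hs i)
  have hvc0 : vc ≠ 0 := fun h => (hvcpos 0).ne' (congrFun h 0)
  have hle := hmax _ ⟨_, hflip x hx, mulVec_sign_flip hbip hAx⟩
  have hge := hmin _ ⟨_, hflip vc hvc0, mulVec_sign_flip hbip hvc⟩
  have heq : -lammin = lammax := by linarith
  have hA : ∀ i k, 0 ≤ A i k := fun i k => by rcases h01 i k with h | h <;> simp [h]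
  obtain ⟨c, hc⟩ := exists_eq_smul_of_pos_eigenvector hA hirr hvc hvcpos
    (heq ▸ mulVec_sign_flip hbip hAx)
  have hxc : ∀ i, x i = (if P i then 1 else -1) * (c * vc i) := fun i => by
    have := congrFun hc i
    rw [Pi.smul_apply, smul_eq_mul] at this
    rw [← this]
    split_ifs <;> ring
  have hc0 : c ≠ 0 := by
    rintro rfl
    exact hx (funext fun i => by simp [hxc i])
  have habs : ∀ i, |x i| = |c| * vc i := fun i => by
    rw [hxc, abs_mul, abs_mul, abs_of_pos (hvcpos i)]
    split_ifs <;> simp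
  refine ⟨fun i => ?_, fun i k => ⟨fun h => ?_, fun h => ?_⟩, fun i k hi hk => ?_⟩
  · rw [hxc]
    exact mul_ne_zero (hs i) (mul_ne_zero hc0 (hvcpos i).ne')
  · rw [habs, habs]
    exact mul_lt_mul_of_pos_left h (abs_pos.2 hc0)
  · rw [habs, habs, h]
  · rw [hxc i, hxc k, if_pos hi, if_neg hk, one_mul, neg_one_mul, Real.sign_neg, neg_neg]
    rcases hc0.lt_or_gt with h | h
    · rw [Real.sign_of_neg (mul_neg_of_neg_of_pos h (hvcpos i)),
        Real.sign_of_neg (mul_neg_of_neg_of_pos h (hvcpos k))]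
    · rw [Real.sign_of_pos (mul_pos h (hvcpos i)), Real.sign_of_pos (mul_pos h (hvcpos k))]
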